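/- Let A and B be disjoint finite index sets, let 0 < η_min ≤ η_i ≤ η_max for all i ∈ A ∪ B, let w_i ≥ 0 for i ∈ A ∪ B and w'_i ≥ 0 for i ∈ A, and let G ≥ 0. Assume (i) w_i ≤ w'_i for every i ∈ A, and (ii) Σ_{i∈B} w_i ≤ (1/2) · Σ_{i∈A} w'_i. Then Σ_{i∈A∪B} (w_i/η_i) + G ≤ (1 + (1/2)·(η_max/η_min)) · ( Σ_{i∈A} (w'_i/η_i) + G ). -/

import Mathlib

/-- Let `A` and `B` be disjoint finite index sets, with
efficiencies `0 < ηmin ≤ η i ≤ ηmax` on `A ∪ B`, works `w i ≥ 0` on `A ∪ B` and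
`w' i ≥ 0` on `A`, and `G ≥ 0`. If `w i ≤ w' i` for every `i ∈ A` and
`∑_{i∈B} w i ≤ (1/2) ∑_{i∈A} w' i`, then
`∑_{i∈A∪B} w i / η i + G ≤ (1 + (1/2) * (ηmax/ηmin)) * (∑_{i∈A} w' i / η i + G)`. -/
theorem stmt_12 {ι : Type*} [DecidableEq ι] (A B : Finset ι)
    (hAB : Disjoint A B)
    (η : ι → ℝ) (ηmin ηmax : ℝ) (hmin : 0 < ηmin) (hminmax : ηmin ≤ ηmax)
    (hηlb : ∀ i ∈ A ∪ B, ηmin ≤ η i) (hηub : ∀ i ∈ A ∪ B, η i ≤ ηmax)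
    (w : ι → ℝ) (hw : ∀ i ∈ A ∪ B, 0 ≤ w i)
    (w' : ι → ℝ) (hw' : ∀ i ∈ A, 0 ≤ w' i)
    (G : ℝ) (hG : 0 ≤ G)
    (hww' : ∀ i ∈ A, w i ≤ w' i)
    (hB : (∑ i ∈ B, w i) ≤ (1 / 2) * ∑ i ∈ A, w' i) :
    (∑ i ∈ A ∪ B, w i / η i) + G ≤
      (1 + (1 / 2) * (ηmax / ηmin)) * ((∑ i ∈ A, w' i / η i) + G) := by
  have η_pos : ∀ i ∈ A ∪ B, 0 < η i := fun i hi => hmin.trans_le (hηlb i hi)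
  have hmax : 0 < ηmax := hmin.trans_le hminmax
  have energy_A : ∑ i ∈ A, w i / η i ≤ ∑ i ∈ A, w' i / η i :=
    Finset.sum_le_sum fun i hi =>
      div_le_div_of_nonneg_right (hww' i hi) (η_pos i (Finset.mem_union_left B hi)).le
  have energy_B : ∑ i ∈ B, w i / η i ≤ (∑ i ∈ B, w i) / ηmin := by
    rw [Finset.sum_div]
    refine Finset.sum_le_sum fun i hi => ?_
    have hi' := Finset.mem_union_right A hi
    exact div_le_div_of_nonneg_left (hw i hi') hmin (hηlb i hi')
  have work_A : ∑ i ∈ A, w' i ≤ ηmax * ∑ i ∈ A, w' i / η i := by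
    rw [Finset.mul_sum]
    refine Finset.sum_le_sum fun i hi => ?_
    have hi' := Finset.mem_union_left B hi
    rw [← mul_div_assoc, le_div_iff₀ (η_pos i hi'), mul_comm]
    exact mul_le_mul_of_nonneg_right (hηub i hi') (hw' i hi)
  have energy_B_le : ∑ i ∈ B, w i / η i ≤ 1 / 2 * (ηmax / ηmin) * ∑ i ∈ A, w' i / η i :=
    calc ∑ i ∈ B, w i / η i ≤ (∑ i ∈ B, w i) / ηmin := energy_B
      _ ≤ (1 / 2 * (ηmax * ∑ i ∈ A, w' i / η i)) / ηmin := by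
        gcongr
        linarith
      _ = 1 / 2 * (ηmax / ηmin) * ∑ i ∈ A, w' i / η i := by ring
  have overhead : 0 ≤ 1 / 2 * (ηmax / ηmin) * G := by positivity
  rw [Finset.sum_union hAB]
  linarith
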